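/- Let S, T be Cu-semigroups and let B ⊆ S be a submonoid of S that is dense in S (every element of S is the supremum of a ≪-increasing sequence of elements of B). Let α : B → T be an additive order-preserving map with α(0)=0. Then: (1) for any two ≪-increasing sequences (b_n), (c_n) in B having the same supremum in S, one has sup_n α(b_n) = sup_n α(c_n); hence the map ᾱ : S → T, ᾱ(s) := sup_n α(b_n) for any ≪-increasing sequence (b_n) in B with sup b_n = s, is well defined; (2) ᾱ is a generalized Cu-morphism (additive, order-preserving, sends 0 to 0, preserves suprema of increasing sequences) and ᾱ(b) ≤ α(b) for every b ∈ B; (3) if moreover α preserves the way-below relation (b' ≪ b in S implies α(b') ≪ α(b) in T for b',b ∈ B), then ᾱ preserves ≪, i.e. ᾱ is a Cu-morphism. -/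

import Mathlib

open Set

/-- `x` is way-below `y`. -/
def WayBelow {S : Type*} [Preorder S] (x y : S) : Prop :=
  ∀ z : ℕ → S, Monotone z → ∀ w : S, IsLUB (Set.range z) w → y ≤ w → ∃ k, x ≤ z k

/-- The set `S_≪` of elements way-below something. -/
def wbSet (S : Type*) [Preorder S] : Set S := {s | ∃ t, WayBelow s t}

/-- `S` is an abstract Cuntz semigroup. -/
structure IsCu (S : Type*) [AddCommMonoid S] [PartialOrder S] [IsOrderedAddMonoid S] : Prop where
  zero_le : ∀ x : S, 0 ≤ x
  O1 : ∀ z : ℕ → S, Monotone z → ∃ w, IsLUB (Set.range z) w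
  O2 : ∀ x : S, ∃ z : ℕ → S, (∀ n, WayBelow (z n) (z (n + 1))) ∧ IsLUB (Set.range z) x
  O3 : ∀ x' x y' y : S, WayBelow x' x → WayBelow y' y → WayBelow (x' + y') (x + y)
  O4 : ∀ x y : ℕ → S, Monotone x → Monotone y → ∀ a b : S, IsLUB (Set.range x) a →
    IsLUB (Set.range y) b → IsLUB (Set.range fun n => x n + y n) (a + b)

/-- Generalized Cu-morphism. -/
structure IsGenCuMorphism {S T : Type*} [AddCommMonoid S] [PartialOrder S] [IsOrderedAddMonoid S] [AddCommMonoid T] [PartialOrder T] [IsOrderedAddMonoid T]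
    (f : S → T) : Prop where
  map_zero : f 0 = 0
  map_add : ∀ x y, f (x + y) = f x + f y
  mono : Monotone f
  map_sup : ∀ (z : ℕ → S) (w : S), Monotone z → IsLUB (Set.range z) w →
    IsLUB (Set.range fun n => f (z n)) (f w)

/-- Cu-morphism. -/
structure IsCuMorphism {S T : Type*} [AddCommMonoid S] [PartialOrder S] [IsOrderedAddMonoid S] [AddCommMonoid T] [PartialOrder T] [IsOrderedAddMonoid T]
    (f : S → T) extends IsGenCuMorphism f : Prop where
  map_wayBelow : ∀ x y, WayBelow x y → WayBelow (f x) (f y)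

/-- A uniform basis of a Cu-semigroup. -/
structure UniformBasis (S : Type*) [AddCommMonoid S] [PartialOrder S] [IsOrderedAddMonoid S] where
  M : ℕ → Set S
  eps : ℕ → S → S
  M_zero : M 0 = {0}
  zero_mem : ∀ n, (0 : S) ∈ M n
  add_mem : ∀ n, ∀ x ∈ M n, ∀ y ∈ M n, x + y ∈ M n
  M_subset : ∀ n, M n ⊆ wbSet S
  eps_mem : ∀ n, ∀ s ∈ wbSet S, eps n s ∈ M n
  eps_mono : ∀ n, ∀ s ∈ wbSet S, ∀ t ∈ wbSet S, s ≤ t → eps n s ≤ eps n t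
  eps_superadd : ∀ n, ∀ s ∈ wbSet S, ∀ t ∈ wbSet S, eps n s + eps n t ≤ eps n (s + t)
  U1 : ∀ n, M n ⊆ M (n + 1)
  U2 : ∀ n s t, (∃ l, l + 1 < n ∧ s ∈ M l) → (∃ l, l + 1 < n ∧ t ∈ M l) →
    eps n (s + t) = eps n s + eps n t
  U3_mono : ∀ s ∈ wbSet S, ∀ n, eps n s ≤ eps (n + 1) s
  U3_wb : ∀ s ∈ wbSet S, ∀ n, WayBelow (eps n s) s
  U3_sup : ∀ s ∈ wbSet S, IsLUB (Set.range fun n => eps n s) s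
  U4 : ∀ l, ∀ s ∈ M l, ∀ n, l < n → WayBelow (eps n s) (eps (n + 1) s)

/-- Strict comparison `α ≈_Λ β` of two maps on a subset `Λ`. -/
def ApproxOn {S T : Type*} [Preorder S] [Preorder T] (α β : S → T) (Λ : Set S) : Prop :=
  ∀ g' ∈ Λ, ∀ g ∈ Λ, WayBelow g' g → WayBelow (α g') (β g) ∧ WayBelow (β g') (α g)

/-- Comparison `α ≃_Λ β` of two maps on a subset `Λ`. -/
def CompareOn {S T : Type*} [Preorder S] [Preorder T] (α β : S → T) (Λ : Set S) : Prop :=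
  ∀ g' ∈ Λ, ∀ g ∈ Λ, WayBelow g' g → α g' ≤ β g ∧ β g' ≤ α g

theorem wb_le_aux {S : Type*} [Preorder S] {x y : S} (h : WayBelow x y) : x ≤ y := by
  obtain ⟨_, hk⟩ := h (fun _ => y) monotone_const y (by simp) le_rfl
  exact hk

theorem wb_trans_aux {S : Type*} [Preorder S] {x y z w : S} (h1 : x ≤ y) (h : WayBelow y z)
    (h2 : z ≤ w) : WayBelow x w := by
  intro s hs t ht hw
  obtain ⟨k, hk⟩ := h s hs t ht (h2.trans hw)
  exact ⟨k, h1.trans hk⟩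

theorem wb_mono_aux {S : Type*} [Preorder S] {b : ℕ → S}
    (h : ∀ n, WayBelow (b n) (b (n + 1))) : Monotone b :=
  monotone_nat_of_le_succ fun n => wb_le_aux (h n)

/-- Extension of a PoM-morphism on a dense submonoid to a (generalized) Cu-morphism. -/
theorem extend_PoM_morphism_from_dense_submonoid
    {S T : Type*} [AddCommMonoid S] [PartialOrder S] [IsOrderedAddMonoid S] [AddCommMonoid T] [PartialOrder T] [IsOrderedAddMonoid T]
    (hS : IsCu S) (hT : IsCu T)
    (B : Set S) (hB0 : (0 : S) ∈ B) (hBadd : ∀ x ∈ B, ∀ y ∈ B, x + y ∈ B)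
    (hdense : ∀ s : S, ∃ b : ℕ → S, (∀ n, b n ∈ B) ∧ (∀ n, WayBelow (b n) (b (n + 1))) ∧
      IsLUB (Set.range b) s)
    (α : S → T) (hα0 : α 0 = 0)
    (hαadd : ∀ x ∈ B, ∀ y ∈ B, α (x + y) = α x + α y)
    (hαmono : ∀ x ∈ B, ∀ y ∈ B, x ≤ y → α x ≤ α y) :
    -- (1) independence of the chosen ≪-increasing sequence
    (∀ b c : ℕ → S, (∀ n, b n ∈ B) → (∀ n, c n ∈ B) →
      (∀ n, WayBelow (b n) (b (n + 1))) → (∀ n, WayBelow (c n) (c (n + 1))) →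
      ∀ s : S, IsLUB (Set.range b) s → IsLUB (Set.range c) s →
      ∀ u v : T, IsLUB (Set.range fun n => α (b n)) u →
        IsLUB (Set.range fun n => α (c n)) v → u = v) ∧
    -- (2) and (3)
    ∃ αbar : S → T, IsGenCuMorphism αbar ∧ (∀ b ∈ B, αbar b ≤ α b) ∧
      (∀ (s : S) (b : ℕ → S), (∀ n, b n ∈ B) → (∀ n, WayBelow (b n) (b (n + 1))) →
        IsLUB (Set.range b) s → IsLUB (Set.range fun n => α (b n)) (αbar s)) ∧
      ((∀ x ∈ B, ∀ y ∈ B, WayBelow x y → WayBelow (α x) (α y)) →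
        ∀ x y : S, WayBelow x y → WayBelow (αbar x) (αbar y)) := by
  have hub : ∀ (b : ℕ → S) (s : S), IsLUB (Set.range b) s → ∀ n, b n ≤ s :=
    fun b s h n => h.1 ⟨n, rfl⟩
  have hubT : ∀ (b : ℕ → T) (s : T), IsLUB (Set.range b) s → ∀ n, b n ≤ s :=
    fun b s h n => h.1 ⟨n, rfl⟩
  have hwb : ∀ (b : ℕ → S) (s : S), (∀ n, WayBelow (b n) (b (n + 1))) →
      IsLUB (Set.range b) s → ∀ n, WayBelow (b n) s :=
    fun b s h hs n => wb_trans_aux le_rfl (h n) (hub b s hs (n + 1))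
  have hmonoα : ∀ b : ℕ → S, (∀ n, b n ∈ B) → (∀ n, WayBelow (b n) (b (n + 1))) →
      Monotone fun n => α (b n) :=
    fun b hb h m n hmn => hαmono _ (hb m) _ (hb n) (wb_mono_aux h hmn)
  -- comparison of one element with a sequence
  have hP : ∀ (x s : S) (c : ℕ → S) (v : T), x ∈ B → WayBelow x s → (∀ n, c n ∈ B) →
      (∀ n, WayBelow (c n) (c (n + 1))) → IsLUB (Set.range c) s →
      IsLUB (Set.range fun n => α (c n)) v → α x ≤ v := by
    intro x s c v hx hxs hc hcw hcs hv
    obtain ⟨k, hk⟩ := hxs c (wb_mono_aux hcw) s hcs le_rfl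
    exact (hαmono _ hx _ (hc k) hk).trans (hubT _ _ hv k)
  have h1 : ∀ b c : ℕ → S, (∀ n, b n ∈ B) → (∀ n, c n ∈ B) →
      (∀ n, WayBelow (b n) (b (n + 1))) → (∀ n, WayBelow (c n) (c (n + 1))) →
      ∀ s : S, IsLUB (Set.range b) s → IsLUB (Set.range c) s →
      ∀ u v : T, IsLUB (Set.range fun n => α (b n)) u →
        IsLUB (Set.range fun n => α (c n)) v → u = v := by
    intro b c hb hc hbw hcw s hbs hcs u v hu hv
    apply le_antisymm
    · apply hu.2
      rintro _ ⟨n, rfl⟩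
      exact hP _ s c v (hb n) (hwb b s hbw hbs n) hc hcw hcs hv
    · apply hv.2
      rintro _ ⟨n, rfl⟩
      exact hP _ s b u (hc n) (hwb c s hcw hcs n) hb hbw hbs hu
  refine ⟨h1, ?_⟩
  choose β hβB hβw hβs using hdense
  have hex : ∀ s : S, ∃ u, IsLUB (Set.range fun n => α (β s n)) u :=
    fun s => hT.O1 _ (hmonoα _ (hβB s) (hβw s))
  choose f hf using hex
  have hseq : ∀ (s : S) (b : ℕ → S), (∀ n, b n ∈ B) → (∀ n, WayBelow (b n) (b (n + 1))) →
      IsLUB (Set.range b) s → IsLUB (Set.range fun n => α (b n)) (f s) := by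
    intro s b hb hbw hbs
    obtain ⟨u, hu⟩ := hT.O1 _ (hmonoα b hb hbw)
    rw [h1 _ _ (hβB s) hb (hβw s) hbw s (hβs s) hbs _ _ (hf s) hu]
    exact hu
  have hQ : ∀ x s : S, x ∈ B → WayBelow x s → α x ≤ f s := fun x s hx hxs =>
    hP x s _ _ hx hxs (hβB s) (hβw s) (hβs s) (hf s)
  have hle : ∀ b ∈ B, f b ≤ α b := by
    intro b hb
    apply (hf b).2
    rintro _ ⟨n, rfl⟩
    exact hαmono _ (hβB b n) _ hb (hub _ _ (hβs b) n)
  have hmono : Monotone f := by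
    intro x y hxy
    apply (hf x).2
    rintro _ ⟨n, rfl⟩
    exact hQ _ _ (hβB x n) (wb_trans_aux le_rfl (hwb _ _ (hβw x) (hβs x) n) hxy)
  refine ⟨f, ⟨?_, ?_, hmono, ?_⟩, hle, hseq, ?_⟩
  · exact le_antisymm ((hle 0 hB0).trans hα0.le) (hT.zero_le _)
  · intro x y
    have hA := hseq (x + y) (fun n => β x n + β y n)
      (fun n => hBadd _ (hβB x n) _ (hβB y n))
      (fun n => hS.O3 _ _ _ _ (hβw x n) (hβw y n))
      (hS.O4 _ _ (wb_mono_aux (hβw x)) (wb_mono_aux (hβw y)) _ _ (hβs x) (hβs y))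
    have hC := hT.O4 _ _ (hmonoα _ (hβB x) (hβw x)) (hmonoα _ (hβB y) (hβw y)) _ _ (hf x) (hf y)
    have hE : (fun n => α (β x n + β y n)) = fun n => α (β x n) + α (β y n) :=
      funext fun n => hαadd _ (hβB x n) _ (hβB y n)
    rw [hE] at hA
    exact hA.unique hC
  · intro z w hz hw
    constructor
    · rintro _ ⟨n, rfl⟩
      exact hmono (hub _ _ hw n)
    · intro v hv
      apply (hf w).2
      rintro _ ⟨n, rfl⟩
      obtain ⟨k, hk⟩ := hwb _ _ (hβw w) (hβs w) (n + 1) z hz w hw le_rfl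
      exact (hQ _ (z k) (hβB w n) (wb_trans_aux le_rfl (hβw w n) hk)).trans (hv ⟨k, rfl⟩)
  · intro hα x y hxy
    obtain ⟨k, hk⟩ := hxy _ (wb_mono_aux (hβw y)) y (hβs y) le_rfl
    exact wb_trans_aux ((hmono hk).trans (hle _ (hβB y k)))
      (hα _ (hβB y k) _ (hβB y (k + 1)) (hβw y k)) (hubT _ _ (hf y) (k + 1))
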